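/- arXiv:2106.02421 — 2 statements merged into one kernel-verified Lean document; each statement's English description precedes it below -/
import Mathlib

section
/- For every λ ≥ 1, the density f_λ(t) = √λ · t · exp(−(λ+1)t²/4) · I₀((λ−1)t²/4) (for t > 0) of X = √(g₁² + λ^{-1}g₂²), where g₁, g₂ are independent standard Gaussians, is log-concave on the interval (3/4, ∞). -/
open MeasureTheory Real

/-- Weighted integrals `∫₀^π exp(s cos θ) g(θ) dθ`. -/
noncomputable def besselIntegral (g : ℝ → ℝ) (s : ℝ) : ℝ :=
  ∫ θ in (0 : ℝ)..π, Real.exp (s * Real.cos θ) * g θ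

/-- The integrals `∫₀^π exp(s cos θ) sin²ⁿ θ dθ`, which are positive multiples of `Iₙ(s) / sⁿ`. -/
noncomputable def besselSin (n : ℕ) : ℝ → ℝ := besselIntegral fun θ => Real.sin θ ^ (2 * n)

theorem hasDerivAt_besselIntegral {g : ℝ → ℝ} (hg : Continuous g) (s : ℝ) :
    HasDerivAt (besselIntegral g) (besselIntegral (fun θ => Real.cos θ * g θ) s) s := by
  have key := intervalIntegral.hasDerivAt_integral_of_dominated_loc_of_deriv_le (μ := volume)
    (a := (0 : ℝ)) (b := π) (F := fun s θ => Real.exp (s * Real.cos θ) * g θ)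
    (F' := fun s θ => Real.exp (s * Real.cos θ) * (Real.cos θ * g θ)) (x₀ := s)
    (s := Metric.ball s 1) (bound := fun θ => Real.exp (|s| + 1) * |g θ|)
    (Metric.ball_mem_nhds s one_pos)
    (Filter.Eventually.of_forall fun x =>
      Continuous.aestronglyMeasurable (by fun_prop))
    (Continuous.intervalIntegrable (by fun_prop) _ _)
    (Continuous.aestronglyMeasurable (by fun_prop))
    (Filter.Eventually.of_forall fun θ _ x hx => ?_)
    (Continuous.intervalIntegrable (by fun_prop) _ _)
    (Filter.Eventually.of_forall fun θ _ x _ => ?_)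
  · exact key.2
  · have hx' : |x| ≤ |s| + 1 := by
      have h1 : |x - s| < 1 := by simpa [Real.dist_eq] using hx
      have h2 := abs_add_le (x - s) s
      rw [sub_add_cancel] at h2
      linarith
    have hc := Real.abs_cos_le_one θ
    have he : x * Real.cos θ ≤ |s| + 1 := by
      refine (le_abs_self _).trans ?_
      rw [abs_mul]
      nlinarith [abs_nonneg x, abs_nonneg (Real.cos θ)]
    rw [Real.norm_eq_abs, abs_mul, abs_mul, Real.abs_exp]
    refine mul_le_mul (Real.exp_le_exp.2 he) ?_ (by positivity) (by positivity)
    nlinarith [abs_nonneg (g θ)]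
  · have h := (((hasDerivAt_id x).mul_const (Real.cos θ)).exp).mul_const (g θ)
    refine h.congr_deriv ?_
    simp only [id]
    ring

theorem besselIntegral_add {f g : ℝ → ℝ} (hf : Continuous f) (hg : Continuous g) (s : ℝ) :
    besselIntegral (fun θ => f θ + g θ) s = besselIntegral f s + besselIntegral g s := by
  simp only [besselIntegral, mul_add]
  exact intervalIntegral.integral_add (Continuous.intervalIntegrable (by fun_prop) _ _)
    (Continuous.intervalIntegrable (by fun_prop) _ _)

theorem besselIntegral_const_mul (c : ℝ) (g : ℝ → ℝ) (s : ℝ) :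
    besselIntegral (fun θ => c * g θ) s = c * besselIntegral g s := by
  simp only [besselIntegral, ← intervalIntegral.integral_const_mul]
  congr 1
  ext θ
  ring

/-- Integration by parts against `exp(s cos θ)`, with vanishing boundary terms. -/
theorem besselIntegral_by_parts {g g' : ℝ → ℝ} (hg : ∀ θ, HasDerivAt g (g' θ) θ)
    (hg' : Continuous g') (h0 : g 0 = 0) (hpi : g π = 0) (s : ℝ) :
    besselIntegral g' s = s * besselIntegral (fun θ => Real.sin θ * g θ) s := by
  have hgc : Continuous g := continuous_iff_continuousAt.2 fun θ => (hg θ).continuousAt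
  have key : besselIntegral (fun θ => g' θ + (-s) * (Real.sin θ * g θ)) s = 0 := by
    have h := intervalIntegral.integral_eq_sub_of_hasDerivAt (a := (0 : ℝ)) (b := π)
      (f := fun θ => Real.exp (s * Real.cos θ) * g θ)
      (f' := fun θ => Real.exp (s * Real.cos θ) * (g' θ + (-s) * (Real.sin θ * g θ)))
      (fun θ _ => by
        have h := (((Real.hasDerivAt_cos θ).const_mul s).exp).mul (hg θ)
        refine h.congr_deriv ?_
        ring)
      (Continuous.intervalIntegrable (by fun_prop) _ _)
    simpa [besselIntegral, h0, hpi] using h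
  rw [besselIntegral_add hg' (by fun_prop), besselIntegral_const_mul] at key
  linarith

theorem besselSin_nonneg (n : ℕ) (s : ℝ) : 0 ≤ besselSin n s :=
  intervalIntegral.integral_nonneg pi_pos.le fun θ _ => by
    have := (even_two_mul n).pow_nonneg (Real.sin θ)
    positivity

theorem besselSin_zero_pos (s : ℝ) : 0 < besselSin 0 s := by
  refine intervalIntegral.intervalIntegral_pos_of_pos
    (Continuous.intervalIntegrable (by fun_prop) _ _) (fun θ => ?_) pi_pos
  simp only [mul_zero, pow_zero, mul_one]
  positivity

/-- The three-term recurrence, equivalent to `Iₙ(s) - Iₙ₊₂(s) = 2(n+1) Iₙ₊₁(s) / s`. -/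
theorem sq_mul_besselSin (n : ℕ) (s : ℝ) :
    s ^ 2 * besselSin (n + 2) s =
      (2 * n + 3) * ((2 * n + 1) * besselSin n s - 2 * (n + 1) * besselSin (n + 1) s) := by
  have h1 := besselIntegral_by_parts (g := fun θ => Real.sin θ ^ (2 * n + 3))
    (g' := fun θ => (2 * n + 3) * (Real.sin θ ^ (2 * n + 2) * Real.cos θ))
    (fun θ => by
      refine HasDerivAt.congr_deriv ((Real.hasDerivAt_sin θ).pow (2 * n + 3)) ?_
      simp only [show 2 * n + 3 - 1 = 2 * n + 2 by omega]
      push_cast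
      ring) (by fun_prop) (by simp) (by simp) s
  have h2 := besselIntegral_by_parts (g := fun θ => Real.sin θ ^ (2 * n + 1) * Real.cos θ)
    (g' := fun θ => (2 * n + 1) * Real.sin θ ^ (2 * n) +
      -(2 * (n + 1)) * Real.sin θ ^ (2 * (n + 1)))
    (fun θ => by
      refine HasDerivAt.congr_deriv
        (((Real.hasDerivAt_sin θ).pow (2 * n + 1)).mul (Real.hasDerivAt_cos θ)) ?_
      simp only [Nat.add_sub_cancel, Pi.pow_apply]
      push_cast
      linear_combination ((2 * n + 1) * Real.sin θ ^ (2 * n)) * Real.sin_sq_add_cos_sq θ)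
    (by fun_prop) (by simp) (by simp) s
  rw [besselIntegral_const_mul] at h1
  rw [besselIntegral_add (by fun_prop) (by fun_prop), besselIntegral_const_mul,
    besselIntegral_const_mul] at h2
  have e1 : (fun θ => Real.sin θ * Real.sin θ ^ (2 * n + 3)) =
      fun θ => Real.sin θ ^ (2 * (n + 2)) := by
    ext θ
    ring
  have e2 : (fun θ => Real.sin θ * (Real.sin θ ^ (2 * n + 1) * Real.cos θ)) =
      fun θ => Real.sin θ ^ (2 * n + 2) * Real.cos θ := by
    ext θ
    ring
  rw [e1] at h1
  rw [e2] at h2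
  simp only [besselSin]
  linear_combination (-s) * h1 - (2 * n + 3) * h2

theorem mul_besselSin_one (s : ℝ) : s * besselSin 1 s = besselIntegral Real.cos s := by
  rw [besselIntegral_by_parts Real.hasDerivAt_sin Real.continuous_cos Real.sin_zero Real.sin_pi s]
  simp only [besselSin, mul_one, sq]

theorem hasDerivAt_besselSin_zero (s : ℝ) :
    HasDerivAt (besselSin 0) (s * besselSin 1 s) s := by
  rw [mul_besselSin_one]
  have h := hasDerivAt_besselIntegral (g := fun θ => Real.sin θ ^ (2 * 0)) (by fun_prop) s
  simp only [mul_zero, pow_zero, mul_one] at h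
  simpa [besselSin] using h

theorem hasDerivAt_mul_besselSin_one (s : ℝ) :
    HasDerivAt (fun s => s * besselSin 1 s) (besselSin 0 s - besselSin 1 s) s := by
  have h := hasDerivAt_besselIntegral Real.continuous_cos s
  have e : besselIntegral (fun θ => Real.cos θ * Real.cos θ) s =
      besselSin 0 s - besselSin 1 s := by
    have hadd := besselIntegral_add (f := fun θ => Real.cos θ * Real.cos θ)
      (g := fun θ => Real.sin θ ^ (2 * 1)) (by fun_prop) (by fun_prop) s
    have e1 : (fun θ => Real.cos θ * Real.cos θ + Real.sin θ ^ (2 * 1)) =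
        fun θ => Real.sin θ ^ (2 * 0) := by
      ext θ
      linear_combination Real.sin_sq_add_cos_sq θ
    rw [e1] at hadd
    simp only [besselSin]
    linarith
  rw [e] at h
  have e2 : (fun s => s * besselSin 1 s) = besselIntegral Real.cos := funext mul_besselSin_one
  rwa [e2]

/-- A rational lower bound for `I₁ / I₀`, equivalent to the nonnegativity of `I₇`. -/
theorem besselSin_one_lower_bound (s : ℝ) :
    (24 * s ^ 4 + 1920 * s ^ 2 + 23040) * besselSin 0 s ≤
      (s ^ 6 + 288 * s ^ 4 + 9600 * s ^ 2 + 46080) * besselSin 1 s := by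
  have h2 := sq_mul_besselSin 0 s
  have h3 := sq_mul_besselSin 1 s
  have h4 := sq_mul_besselSin 2 s
  have h5 := sq_mul_besselSin 3 s
  have h6 := sq_mul_besselSin 4 s
  have h7 := sq_mul_besselSin 5 s
  norm_num at h2 h3 h4 h5 h6 h7
  have e3 : s ^ 4 * besselSin 3 s =
      5 * (3 * s ^ 2 * besselSin 1 s - 4 * (s ^ 2 * besselSin 2 s)) := by
    linear_combination s ^ 2 * h3
  have e4 : s ^ 6 * besselSin 4 s =
      7 * (5 * s ^ 2 * (s ^ 2 * besselSin 2 s) - 6 * (s ^ 4 * besselSin 3 s)) := by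
    linear_combination s ^ 4 * h4
  have e5 : s ^ 8 * besselSin 5 s =
      9 * (7 * s ^ 2 * (s ^ 4 * besselSin 3 s) - 8 * (s ^ 6 * besselSin 4 s)) := by
    linear_combination s ^ 6 * h5
  have e6 : s ^ 10 * besselSin 6 s =
      11 * (9 * s ^ 2 * (s ^ 6 * besselSin 4 s) - 10 * (s ^ 8 * besselSin 5 s)) := by
    linear_combination s ^ 8 * h6
  have e7 : s ^ 12 * besselSin 7 s =
      13 * (11 * s ^ 2 * (s ^ 8 * besselSin 5 s) - 12 * (s ^ 10 * besselSin 6 s)) := by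
    linear_combination s ^ 10 * h7
  have hpos : 0 ≤ s ^ 12 * besselSin 7 s :=
    mul_nonneg (by positivity) (besselSin_nonneg 7 s)
  rw [e7, e6, e5, e4, e3, h2] at hpos
  linarith

theorem rational_bound_poly {s : ℝ} (hs : 0 ≤ s) (hs' : s ≤ 13 / 5) :
    (4 * s ^ 2 - 2 * s - 25 / 16) * (s ^ 6 + 288 * s ^ 4 + 9600 * s ^ 2 + 46080) ^ 2 ≤
      (2 * s ^ 2 * (24 * s ^ 4 + 1920 * s ^ 2 + 23040)) ^ 2 +
        2 * s ^ 2 * (24 * s ^ 4 + 1920 * s ^ 2 + 23040) *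
          (s ^ 6 + 288 * s ^ 4 + 9600 * s ^ 2 + 46080) := by
  have h : 0 ≤ 13 - 5 * s := by linarith
  have hpos : 0 ≤ 53084160000 * (13 - 5 * s) ^ 14 +
        4599211622400 * s ^ 1 * (13 - 5 * s) ^ 13 +
        164695552819200 * s ^ 2 * (13 - 5 * s) ^ 12 +
        3390800265216000 * s ^ 3 * (13 - 5 * s) ^ 11 +
        45678273782169600 * s ^ 4 * (13 - 5 * s) ^ 10 +
        428936453248942080 * s ^ 5 * (13 - 5 * s) ^ 9 +
        2898680150693283840 * s ^ 6 * (13 - 5 * s) ^ 8 +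
        14275560364641239040 * s ^ 7 * (13 - 5 * s) ^ 7 +
        51095102125644445440 * s ^ 8 * (13 - 5 * s) ^ 6 +
        130457994921527529984 * s ^ 9 * (13 - 5 * s) ^ 5 +
        228401003635713260352 * s ^ 10 * (13 - 5 * s) ^ 4 +
        255155574944967201024 * s ^ 11 * (13 - 5 * s) ^ 3 +
        161424566910989569993 * s ^ 12 * (13 - 5 * s) ^ 2 +
        55036479512097551226 * s ^ 13 * (13 - 5 * s) ^ 1 +
        22052715949047359809 * s ^ 14 := by
    positivity
  rw [← sub_nonneg]
  refine nonneg_of_mul_nonneg_right (hpos.trans_eq ?_) (show (0 : ℝ) < 16 * 13 ^ 14 by norm_num)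
  ring

/-- The quantity `2 s I₁(s) / I₀(s)`. -/
noncomputable def besselQuot (s : ℝ) : ℝ := 2 * s * (s * besselSin 1 s) / besselSin 0 s

theorem besselQuot_nonneg (s : ℝ) : 0 ≤ besselQuot s := by
  refine div_nonneg ?_ (besselSin_nonneg 0 s)
  nlinarith [mul_nonneg (sq_nonneg s) (besselSin_nonneg 1 s)]

/-- The Riccati equation for `2 s I₁(s) / I₀(s)`. -/
theorem hasDerivAt_besselQuot {s : ℝ} (hs : 0 < s) :
    HasDerivAt besselQuot (2 * s - besselQuot s ^ 2 / (2 * s)) s := by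
  have hA := (besselSin_zero_pos s).ne'
  have h := (((hasDerivAt_id s).const_mul 2).mul (hasDerivAt_mul_besselSin_one s)).div
    (hasDerivAt_besselSin_zero s) hA
  refine h.congr_deriv ?_
  simp only [besselQuot, id, Pi.mul_apply]
  field_simp
  ring

theorem besselQuot_bound_of_le {s : ℝ} (hs : 0 ≤ s) (hs' : s ≤ 13 / 5) :
    4 * s ^ 2 - 2 * s - 25 / 16 ≤ besselQuot s ^ 2 + besselQuot s := by
  have hA := besselSin_zero_pos s
  set D := s ^ 6 + 288 * s ^ 4 + 9600 * s ^ 2 + 46080 with hD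
  set N := 2 * s ^ 2 * (24 * s ^ 4 + 1920 * s ^ 2 + 23040) with hN
  have hDpos : 0 < D := by positivity
  have hNpos : 0 ≤ N := by positivity
  have hle : N / D ≤ besselQuot s := by
    rw [besselQuot, div_le_div_iff₀ hDpos hA]
    have := mul_le_mul_of_nonneg_left (besselSin_one_lower_bound s)
      (show 0 ≤ 2 * s ^ 2 by positivity)
    linarith
  have hx : 0 ≤ N / D := by positivity
  have hpoly : 4 * s ^ 2 - 2 * s - 25 / 16 ≤ (N / D) ^ 2 + N / D := by
    have e : (N / D) ^ 2 + N / D = (N ^ 2 + N * D) / D ^ 2 := by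
      field_simp
    rw [e, le_div_iff₀ (by positivity)]
    exact rational_bound_poly hs hs'
  nlinarith

theorem besselQuot_bound {s : ℝ} (hs : 0 ≤ s) :
    4 * s ^ 2 - 2 * s - 25 / 16 ≤ besselQuot s ^ 2 + besselQuot s := by
  rcases le_total s (13 / 5) with hs' | hs'
  · exact besselQuot_bound_of_le hs hs'
  have hderiv : ∀ u : ℝ, 13 / 5 ≤ u → HasDerivAt
      (fun u => 4 * u ^ 2 - 2 * u - 25 / 16 - (besselQuot u ^ 2 + besselQuot u))
      (8 * u - 2 - (2 * besselQuot u + 1) * (2 * u - besselQuot u ^ 2 / (2 * u))) u := by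
    intro u hu
    have hq := hasDerivAt_besselQuot (s := u) (by linarith)
    have h := (((((hasDerivAt_id u).pow 2).const_mul 4).sub
      ((hasDerivAt_id u).const_mul 2)).sub_const (25 / 16)).sub ((hq.pow 2).add hq)
    refine h.congr_deriv ?_
    simp only [id]
    push_cast
    ring
  have key := image_le_of_deriv_right_lt_deriv_boundary' (a := 13 / 5) (b := s)
    (fun u hu => (hderiv u hu.1).continuousAt.continuousWithinAt)
    (fun u hu => (hderiv u hu.1).hasDerivWithinAt) (B := fun _ => 0) (B' := fun _ => 0)
    (by linarith [besselQuot_bound_of_le (s := 13 / 5) (by norm_num) le_rfl])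
    continuousOn_const (fun u _ => hasDerivWithinAt_const u _ 0) ?_ ⟨hs', le_rfl⟩
  · linarith
  intro u hu hzero
  have hu1 : 13 / 5 ≤ u := hu.1
  have hu0 : 0 < u := by linarith
  have hx0 := besselQuot_nonneg u
  generalize besselQuot u = x at hzero hx0 ⊢
  have hlin : 4 * u ^ 2 - u + 25 / 32 < x * (2 * u + 17 / 16) := by
    by_contra! hcon
    have hsq : (x ^ 2 + x) * (2 * u + 17 / 16) ^ 2 ≤
        (4 * u ^ 2 - u + 25 / 32) ^ 2 + (4 * u ^ 2 - u + 25 / 32) * (2 * u + 17 / 16) := by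
      have h0 : 0 ≤ x * (2 * u + 17 / 16) := by positivity
      nlinarith [mul_le_mul_of_nonneg_right hcon (show 0 ≤ 2 * u + 17 / 16 by positivity)]
    rw [show x ^ 2 + x = 4 * u ^ 2 - 2 * u - 25 / 16 by linarith] at hsq
    nlinarith [mul_nonneg (sub_nonneg.2 hu1) (sub_nonneg.2 hu1),
      mul_nonneg (mul_nonneg (sub_nonneg.2 hu1) (sub_nonneg.2 hu1)) (sub_nonneg.2 hu1)]
  have e : 8 * u - 2 - (2 * x + 1) * (2 * u - x ^ 2 / (2 * u)) =
      (4 * u ^ 2 - u + 25 / 32 - x * (2 * u + 17 / 16)) / u := by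
    field_simp
    have hx2 : x ^ 2 = 4 * u ^ 2 - 2 * u - 25 / 16 - x := by linarith
    have hx3 : x ^ 3 = x * (4 * u ^ 2 - 2 * u - 25 / 16 - x) := by rw [← hx2]; ring
    ring_nf
    rw [hx3, hx2]
    ring_nf
    rw [hx2]
    ring
  rw [e]
  exact div_neg_of_neg_of_pos (by linarith) hu0

/-- For every `λ ≥ 1`, the density `f_λ(t) = √λ t exp(-(λ+1)t²/4) I₀((λ-1)t²/4)` of
`√(g₁² + λ⁻¹ g₂²)` is log-concave on `(3/4, ∞)`.  Here
`I₀(s) = (1/π) ∫₀^π exp(s cos θ) dθ` is the modified Bessel function of the first kind. -/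
theorem stmt4 (lam : ℝ) (hlam : 1 ≤ lam)
    (I₀ : ℝ → ℝ) (hI₀ : I₀ = fun s => (1 / π) * ∫ θ in (0 : ℝ)..π, Real.exp (s * Real.cos θ))
    (f : ℝ → ℝ)
    (hf : f = fun t => Real.sqrt lam * t * Real.exp (-((lam + 1) / 4) * t ^ 2)
        * I₀ ((lam - 1) / 4 * t ^ 2)) :
    ConcaveOn ℝ (Set.Ioi (3 / 4 : ℝ)) (fun t => Real.log (f t)) := by
  obtain ⟨a, rfl⟩ : ∃ a, lam = 4 * a + 1 := ⟨(lam - 1) / 4, by ring⟩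
  have ha : 0 ≤ a := by linarith
  have hI : ∀ s, I₀ s = (1 / π) * besselSin 0 s := fun s => by
    simp [hI₀, besselSin, besselIntegral]
  have hlog : Set.EqOn (fun t => Real.log (√(4 * a + 1)) + Real.log (1 / π) + Real.log t -
      (a + 1 / 2) * t ^ 2 + Real.log (besselSin 0 (a * t ^ 2)))
      (fun t => Real.log (f t)) (Set.Ioi (3 / 4)) := by
    intro t ht
    have ht0 : t ≠ 0 := (show (0 : ℝ) < t by linarith [Set.mem_Ioi.1 ht]).ne'
    have hl : √(4 * a + 1) ≠ 0 := (Real.sqrt_pos.2 (by linarith)).ne'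
    have hA := (besselSin_zero_pos (a * t ^ 2)).ne'
    have hpi : 1 / π ≠ 0 := by positivity
    simp only [hf, hI]
    rw [show (4 * a + 1 - 1) / 4 = a by ring, Real.log_mul (by positivity) (by positivity),
      Real.log_mul (by positivity) (by positivity), Real.log_mul hl ht0, Real.log_mul hpi hA,
      Real.log_exp]
    ring
  refine ConcaveOn.congr ?_ hlog
  have hsq : ∀ t : ℝ, HasDerivAt (fun t => a * t ^ 2) (2 * a * t) t := fun t => by
    refine HasDerivAt.congr_deriv (((hasDerivAt_id t).pow 2).const_mul a) ?_
    simp only [id]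
    push_cast
    ring
  have hA' : ∀ t : ℝ, HasDerivAt (fun t => besselSin 0 (a * t ^ 2))
      (a * t ^ 2 * besselSin 1 (a * t ^ 2) * (2 * a * t)) t := fun t =>
    (hasDerivAt_besselSin_zero (a * t ^ 2)).comp t (hsq t)
  have hB' : ∀ t : ℝ, HasDerivAt (fun t => a * t ^ 2 * besselSin 1 (a * t ^ 2))
      ((besselSin 0 (a * t ^ 2) - besselSin 1 (a * t ^ 2)) * (2 * a * t)) t := fun t =>
    HasDerivAt.comp (h₂ := fun s => s * besselSin 1 s) t (hasDerivAt_mul_besselSin_one _) (hsq t)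
  have h1 : ∀ t ∈ Set.Ioi (3 / 4 : ℝ), HasDerivAt
      (fun t => Real.log (√(4 * a + 1)) + Real.log (1 / π) + Real.log t -
        (a + 1 / 2) * t ^ 2 + Real.log (besselSin 0 (a * t ^ 2)))
      (t⁻¹ - (2 * a + 1) * t +
        (a * t ^ 2 * besselSin 1 (a * t ^ 2)) * (2 * a * t) / besselSin 0 (a * t ^ 2)) t := by
    intro t ht
    have ht0 : t ≠ 0 := (show (0 : ℝ) < t by linarith [Set.mem_Ioi.1 ht]).ne'
    have hA := (besselSin_zero_pos (a * t ^ 2)).ne'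
    have h := (((Real.hasDerivAt_log ht0).const_add
      (Real.log (√(4 * a + 1)) + Real.log (1 / π))).sub
      (((hasDerivAt_id t).pow 2).const_mul (a + 1 / 2))).add
      ((hA' t).log hA)
    refine h.congr_deriv ?_
    simp only [id]
    push_cast
    ring
  have h2 : ∀ t ∈ Set.Ioi (3 / 4 : ℝ), HasDerivAt
      (fun t => t⁻¹ - (2 * a + 1) * t +
        (a * t ^ 2 * besselSin 1 (a * t ^ 2)) * (2 * a * t) / besselSin 0 (a * t ^ 2))
      ((4 * (a * t ^ 2) ^ 2 - 2 * (a * t ^ 2) - 1 - t ^ 2 -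
        (besselQuot (a * t ^ 2) ^ 2 + besselQuot (a * t ^ 2))) / t ^ 2) t := by
    intro t ht
    have ht0 : t ≠ 0 := (show (0 : ℝ) < t by linarith [Set.mem_Ioi.1 ht]).ne'
    have hA := (besselSin_zero_pos (a * t ^ 2)).ne'
    have h := ((hasDerivAt_inv ht0).sub ((hasDerivAt_id t).const_mul (2 * a + 1))).add
      (((hB' t).mul ((hasDerivAt_id t).const_mul (2 * a))).div (hA' t) hA)
    refine h.congr_deriv ?_
    simp only [id, besselQuot, Pi.mul_apply]
    generalize besselSin 0 (a * t ^ 2) = A at hA ⊢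
    field_simp
    ring
  refine concaveOn_of_hasDerivWithinAt2_nonpos (convex_Ioi _)
    (fun t ht => (h1 t ht).continuousAt.continuousWithinAt)
    (fun t ht => (h1 t (interior_subset ht)).hasDerivWithinAt)
    (fun t ht => (h2 t (interior_subset ht)).hasDerivWithinAt) fun t ht => ?_
  have ht' : 3 / 4 < t := interior_subset ht
  have hb := besselQuot_bound (s := a * t ^ 2) (by positivity)
  refine div_nonpos_of_nonpos_of_nonneg ?_ (sq_nonneg t)
  nlinarith
end

section
/- Let X = √(g₁² + λ^{-1}g₂²) with λ ≥ 1 and g₁, g₂ independent standard Gaussians. For every t > 1 there exists 0 < u < t such that E[(X − u)₊³] ≤ 3824·(t − u)³·P(X > t). -/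
open MeasureTheory ProbabilityTheory

/-- The Gaussian radial integral beyond radius `a`. -/
lemma lintegral_Ioi_mul_exp_neg_mul_sq {β : ℝ} (hβ : 0 < β) {a : ℝ} (ha : 0 ≤ a) (c : ℝ)
    (hc : 0 ≤ c) :
    ∫⁻ r in Set.Ioi a, ENNReal.ofReal (c * (r * Real.exp (-β * r ^ 2))) =
      ENNReal.ofReal (c * (Real.exp (-β * a ^ 2) / (2 * β))) := by
  have hderiv : ∀ x ∈ Set.Ici a, HasDerivAt
      (fun r : ℝ => -(c * (Real.exp (-β * r ^ 2) / (2 * β))))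
      (c * (x * Real.exp (-β * x ^ 2))) x := by
    intro x _
    have h := (((((hasDerivAt_id x).pow 2).const_mul (-β)).exp.div_const (2 * β)).const_mul c).neg
    refine h.congr_deriv ?_
    simp only [id, Pi.pow_apply, Nat.cast_ofNat, Nat.add_one_sub_one, pow_one, mul_one]
    field_simp
  have hnonneg : ∀ x ∈ Set.Ioi a, 0 ≤ c * (x * Real.exp (-β * x ^ 2)) := by
    intro x hx
    have : 0 ≤ x := ha.trans (le_of_lt hx)
    positivity
  have hlim : Filter.Tendsto (fun r : ℝ => -(c * (Real.exp (-β * r ^ 2) / (2 * β))))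
      Filter.atTop (nhds 0) := by
    have h1 : Filter.Tendsto (fun r : ℝ => -β * r ^ 2) Filter.atTop Filter.atBot :=
      (Filter.tendsto_pow_atTop two_ne_zero).const_mul_atTop_of_neg (by linarith)
    simpa using (((Real.tendsto_exp_atBot.comp h1).div_const (2 * β)).const_mul c).neg
  rw [← ofReal_integral_eq_lintegral_ofReal
    (integrableOn_Ioi_deriv_of_nonneg' hderiv hnonneg hlim)
    ((ae_restrict_iff' measurableSet_Ioi).2 (ae_of_all _ hnonneg)),
    integral_Ioi_of_hasDerivAt_of_nonneg' hderiv hnonneg hlim]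
  simp

/-- The standard Gaussian measure on the plane in polar coordinates. -/
lemma lintegral_gaussianReal_prod_polar (f : ℝ × ℝ → ENNReal) (hf : Measurable f) :
    ∫⁻ p, f p ∂((gaussianReal 0 1).prod (gaussianReal 0 1)) =
      ∫⁻ θ in Set.Ioo (-Real.pi) Real.pi, ∫⁻ r in Set.Ioi (0 : ℝ),
        f (r * Real.cos θ, r * Real.sin θ) *
          ENNReal.ofReal ((2 * Real.pi)⁻¹ * (r * Real.exp (-(1 / 2) * r ^ 2))) := by
  rw [gaussianReal_of_var_ne_zero 0 one_ne_zero,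
    prod_withDensity (measurable_gaussianPDF 0 1) (measurable_gaussianPDF 0 1),
    lintegral_withDensity_eq_lintegral_mul _ (by fun_prop) hf, ← Measure.volume_eq_prod,
    ← lintegral_comp_polarCoord_symm, polarCoord_target, Measure.volume_eq_prod,
    setLIntegral_prod_symm]
  · refine lintegral_congr fun θ => setLIntegral_congr_fun measurableSet_Ioi fun r hr => ?_
    have hr' : (0 : ℝ) ≤ r := le_of_lt hr
    simp only [polarCoord_symm_apply, Pi.mul_apply, smul_eq_mul, gaussianPDF]
    rw [mul_comm _ (f _), mul_left_comm,
      ← ENNReal.ofReal_mul (gaussianPDFReal_nonneg _ _ _), ← ENNReal.ofReal_mul hr']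
    congr 2
    simp only [gaussianPDFReal, NNReal.coe_one, mul_one, sub_zero]
    rw [mul_mul_mul_comm, ← Real.exp_add, ← mul_inv, Real.mul_self_sqrt (by positivity),
      mul_left_comm]
    congr 4
    linear_combination (-(r ^ 2) / 2) * Real.sin_sq_add_cos_sq θ
  · have h1 : Measurable fun p : ℝ × ℝ => polarCoord.symm p := by
      simp only [polarCoord_symm_apply]
      fun_prop
    have h2 : Measurable ((fun z : ℝ × ℝ => gaussianPDF 0 1 z.1 * gaussianPDF 0 1 z.2) * f) :=
      Measurable.mul (by fun_prop) hf
    exact (measurable_fst.ennreal_ofReal.mul (h2.comp h1)).aemeasurable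

/-- Along a ray, an exponential weight of rate `1/4` beyond a threshold costs a factor two. -/
lemma lintegral_ray_exp_le {T k c : ℝ} (hT : 0 < T) (hk : 0 ≤ k) (hk1 : k ≤ 1) (hc : 0 ≤ c) :
    ∫⁻ r in Set.Ioi (0 : ℝ),
        (if T < k * r ^ 2 then ENNReal.ofReal (Real.exp ((k * r ^ 2 - T) / 4)) else 0) *
          ENNReal.ofReal (c * (r * Real.exp (-(1 / 2) * r ^ 2))) ≤
      2 * ∫⁻ r in Set.Ioi (0 : ℝ), (if T < k * r ^ 2 then 1 else 0) *
          ENNReal.ofReal (c * (r * Real.exp (-(1 / 2) * r ^ 2))) := by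
  rcases hk.eq_or_lt with rfl | hk
  · simp [hT.not_gt]
  set a := √(T / k) with ha_def
  have ha : 0 ≤ a := Real.sqrt_nonneg _
  have hka : k * a ^ 2 = T := by
    rw [ha_def, Real.sq_sqrt (by positivity)]
    field_simp
  have hiff : ∀ r : ℝ, 0 < r → (T < k * r ^ 2 ↔ a < r) := by
    intro r hr
    rw [ha_def, Real.sqrt_lt' hr, div_lt_iff₀ hk, mul_comm]
  have hleft : ∫⁻ r in Set.Ioi (0 : ℝ),
        (if T < k * r ^ 2 then ENNReal.ofReal (Real.exp ((k * r ^ 2 - T) / 4)) else 0) *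
          ENNReal.ofReal (c * (r * Real.exp (-(1 / 2) * r ^ 2))) =
      ∫⁻ r in Set.Ioi a, ENNReal.ofReal
        ((c * Real.exp (-T / 4)) * (r * Real.exp (-(1 / 2 - k / 4) * r ^ 2))) := by
    rw [← lintegral_indicator measurableSet_Ioi, ← lintegral_indicator measurableSet_Ioi]
    refine lintegral_congr fun r => ?_
    by_cases hr : 0 < r
    · by_cases har : a < r
      · simp only [Set.indicator, Set.mem_Ioi, hr, har, (hiff r hr).2 har, if_true]
        rw [← ENNReal.ofReal_mul (Real.exp_nonneg _)]
        congr 1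
        have : Real.exp ((k * r ^ 2 - T) / 4) * Real.exp (-(1 / 2) * r ^ 2) =
            Real.exp (-T / 4) * Real.exp (-(1 / 2 - k / 4) * r ^ 2) := by
          rw [← Real.exp_add, ← Real.exp_add]
          ring_nf
        linear_combination c * r * this
      · simp [Set.indicator, hr, har, hiff r hr]
    · have : ¬ a < r := fun h => hr (ha.trans_lt h)
      simp [Set.indicator, hr, this]
  have hright : ∫⁻ r in Set.Ioi (0 : ℝ), (if T < k * r ^ 2 then 1 else 0) *
          ENNReal.ofReal (c * (r * Real.exp (-(1 / 2) * r ^ 2))) =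
      ∫⁻ r in Set.Ioi a, ENNReal.ofReal (c * (r * Real.exp (-(1 / 2) * r ^ 2))) := by
    rw [← lintegral_indicator measurableSet_Ioi, ← lintegral_indicator measurableSet_Ioi]
    refine lintegral_congr fun r => ?_
    by_cases hr : 0 < r
    · by_cases har : a < r <;> simp [Set.indicator, hr, har, hiff r hr]
    · have : ¬ a < r := fun h => hr (ha.trans_lt h)
      simp [Set.indicator, hr, this]
  rw [hleft, hright, lintegral_Ioi_mul_exp_neg_mul_sq (by linarith) ha _ (by positivity),
    lintegral_Ioi_mul_exp_neg_mul_sq (by norm_num) ha _ hc,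
    ← ENNReal.ofReal_ofNat 2, ← ENNReal.ofReal_mul (by norm_num)]
  refine ENNReal.ofReal_le_ofReal ?_
  have hexp : Real.exp (-T / 4) * Real.exp (-(1 / 2 - k / 4) * a ^ 2) =
      Real.exp (-(1 / 2) * a ^ 2) := by
    rw [← Real.exp_add]
    congr 1
    linear_combination hka / 4
  rw [mul_assoc, ← mul_div_assoc, hexp, mul_left_comm 2 c]
  refine mul_le_mul_of_nonneg_left ?_ hc
  rw [div_le_iff₀ (by linarith)]
  have := Real.exp_pos (-(1 / 2) * a ^ 2)
  nlinarith [mul_nonneg this.le (sub_nonneg.2 hk1)]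

/-- Exponential moment of the overshoot of the quadratic form `x² + s y²` above a level. -/
lemma lintegral_exp_overshoot_le {s T : ℝ} (hs : 0 ≤ s) (hs1 : s ≤ 1) (hT : 0 < T) :
    ∫⁻ p : ℝ × ℝ, (if T < p.1 ^ 2 + s * p.2 ^ 2 then
        ENNReal.ofReal (Real.exp ((p.1 ^ 2 + s * p.2 ^ 2 - T) / 4)) else 0)
        ∂((gaussianReal 0 1).prod (gaussianReal 0 1)) ≤
      2 * ((gaussianReal 0 1).prod (gaussianReal 0 1)) {p | T < p.1 ^ 2 + s * p.2 ^ 2} := by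
  have hmeas : MeasurableSet {p : ℝ × ℝ | T < p.1 ^ 2 + s * p.2 ^ 2} :=
    measurableSet_lt (by fun_prop) (by fun_prop)
  have hmeas_if : ∀ f : ℝ × ℝ → ENNReal, Measurable f →
      Measurable fun p : ℝ × ℝ => if T < p.1 ^ 2 + s * p.2 ^ 2 then f p else 0 :=
    fun f hf => Measurable.ite hmeas hf measurable_const
  have hone : ((gaussianReal 0 1).prod (gaussianReal 0 1)) {p | T < p.1 ^ 2 + s * p.2 ^ 2} =
      ∫⁻ p : ℝ × ℝ, (if T < p.1 ^ 2 + s * p.2 ^ 2 then 1 else 0)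
        ∂((gaussianReal 0 1).prod (gaussianReal 0 1)) := by
    rw [← lintegral_indicator_one hmeas]
    rfl
  rw [hone, lintegral_gaussianReal_prod_polar _ (hmeas_if _ (by fun_prop)),
    lintegral_gaussianReal_prod_polar _ (hmeas_if _ (by fun_prop)),
    ← lintegral_const_mul' _ _ (by norm_num)]
  refine lintegral_mono fun θ => ?_
  have hform : ∀ r : ℝ, (r * Real.cos θ) ^ 2 + s * (r * Real.sin θ) ^ 2 =
      (Real.cos θ ^ 2 + s * Real.sin θ ^ 2) * r ^ 2 := fun r => by ring
  simp only [hform]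
  refine lintegral_ray_exp_le hT (by positivity) ?_ (by positivity)
  nlinarith [Real.sin_sq_add_cos_sq θ, sq_nonneg (Real.sin θ)]

lemma gaussianPDFReal_le_of_sq_le {x y : ℝ} (h : x ^ 2 ≤ y ^ 2) :
    gaussianPDFReal 0 1 y ≤ gaussianPDFReal 0 1 x := by
  simp only [gaussianPDFReal, NNReal.coe_one, mul_one, sub_zero]
  gcongr

/-- The standard Gaussian squared charges a window of length `δ` below a level by at most a
constant times its mass above that level. -/
lemma gaussianReal_window_le {b δ : ℝ} (hδ : 0 ≤ δ) :
    gaussianReal 0 1 {x | b - δ < x ^ 2 ∧ x ^ 2 ≤ b} ≤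
      ENNReal.ofReal (Real.exp (2 * δ)) * gaussianReal 0 1 {x | b < x ^ 2} := by
  rcases lt_or_ge b 0 with hb | hb
  · have : {x : ℝ | b - δ < x ^ 2 ∧ x ^ 2 ≤ b} = ∅ := by
      ext x
      simp only [Set.mem_ofPred_eq, Set.mem_empty_iff_false, iff_false, not_and, not_le]
      intro _
      nlinarith [sq_nonneg x]
    simp [this]
  set a := √b with ha_def
  set e := √(b - δ) with he_def
  have ha : 0 ≤ a := Real.sqrt_nonneg _
  have he : 0 ≤ e := Real.sqrt_nonneg _
  have hab : a ^ 2 = b := Real.sq_sqrt hb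
  have hea : e ≤ a := Real.sqrt_le_sqrt (by linarith)
  have hea_mul : a * (a - e) ≤ δ := by
    have hed : b - δ ≤ e ^ 2 := by
      rcases le_total 0 (b - δ) with h | h
      · rw [he_def, Real.sq_sqrt h]
      · exact h.trans (sq_nonneg e)
    nlinarith [mul_le_mul_of_nonneg_left hea he]
  have habs : ∀ x : ℝ, b - δ < x ^ 2 → e ≤ |x| := fun x hx => by
    rw [← Real.sqrt_sq_eq_abs]
    exact Real.sqrt_le_sqrt hx.le
  have hvol : volume {x : ℝ | b - δ < x ^ 2 ∧ x ^ 2 ≤ b} ≤ ENNReal.ofReal (2 * (a - e)) := by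
    calc volume {x : ℝ | b - δ < x ^ 2 ∧ x ^ 2 ≤ b}
        ≤ volume (Set.Icc e a ∪ Set.Icc (-a) (-e)) := by
          refine measure_mono fun x hx => ?_
          have h1 := habs x hx.1
          have h2 : |x| ≤ a := Real.abs_le_sqrt hx.2
          rcases abs_cases x with ⟨h, _⟩ | ⟨h, _⟩
          · exact Or.inl ⟨by linarith, by linarith⟩
          · exact Or.inr ⟨by linarith, by linarith⟩
      _ ≤ volume (Set.Icc e a) + volume (Set.Icc (-a) (-e)) := measure_union_le _ _
      _ = ENNReal.ofReal (2 * (a - e)) := by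
          rw [Real.volume_Icc, Real.volume_Icc,
            ← ENNReal.ofReal_add (by linarith) (by linarith)]
          congr 1
          ring
  have hupper : gaussianReal 0 1 {x | b - δ < x ^ 2 ∧ x ^ 2 ≤ b} ≤
      gaussianPDF 0 1 e * ENNReal.ofReal (2 * (a - e)) := by
    rw [gaussianReal_apply 0 one_ne_zero]
    refine (setLIntegral_mono (g := fun _ => gaussianPDF 0 1 e) measurable_const
      fun x hx => ?_).trans ?_
    · refine ENNReal.ofReal_le_ofReal (gaussianPDFReal_le_of_sq_le ?_)
      rw [← sq_abs x]
      exact pow_le_pow_left₀ he (habs x hx.1) 2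
    · rw [setLIntegral_const]
      gcongr
  have hlower : gaussianPDF 0 1 (2 * a - e) * ENNReal.ofReal (2 * (a - e)) ≤
      gaussianReal 0 1 {x | b < x ^ 2} := by
    have hdisj : Disjoint (Set.Ioc a (2 * a - e)) (Set.Ico (-(2 * a - e)) (-a)) :=
      Set.disjoint_left.2 fun x hx hx' => by linarith [hx.1, hx'.2]
    have hsub : Set.Ioc a (2 * a - e) ∪ Set.Ico (-(2 * a - e)) (-a) ⊆ {x | b < x ^ 2} := by
      rintro x (hx | hx)
      · exact show b < x ^ 2 by nlinarith [hx.1]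
      · exact show b < x ^ 2 by nlinarith [hx.2]
    refine le_trans ?_ (measure_mono hsub)
    rw [gaussianReal_apply 0 one_ne_zero]
    have hv : volume (Set.Ioc a (2 * a - e) ∪ Set.Ico (-(2 * a - e)) (-a)) =
        ENNReal.ofReal (2 * (a - e)) := by
      rw [measure_union hdisj measurableSet_Ico, Real.volume_Ioc, Real.volume_Ico,
        ← ENNReal.ofReal_add (by linarith) (by linarith)]
      congr 1
      ring
    rw [← hv, ← setLIntegral_const]
    refine setLIntegral_mono (measurable_gaussianPDF 0 1) fun x hx => ?_
    refine ENNReal.ofReal_le_ofReal (gaussianPDFReal_le_of_sq_le ?_)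
    rcases hx with hx | hx
    · nlinarith [hx.1, hx.2]
    · nlinarith [hx.1, hx.2]
  have hratio : gaussianPDF 0 1 e ≤
      ENNReal.ofReal (Real.exp (2 * δ)) * gaussianPDF 0 1 (2 * a - e) := by
    simp only [gaussianPDF]
    rw [← ENNReal.ofReal_mul (Real.exp_nonneg _)]
    refine ENNReal.ofReal_le_ofReal ?_
    simp only [gaussianPDFReal, NNReal.coe_one, mul_one, sub_zero]
    rw [mul_left_comm, ← Real.exp_add]
    gcongr
    linarith
  calc gaussianReal 0 1 {x | b - δ < x ^ 2 ∧ x ^ 2 ≤ b}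
      ≤ gaussianPDF 0 1 e * ENNReal.ofReal (2 * (a - e)) := hupper
    _ ≤ ENNReal.ofReal (Real.exp (2 * δ)) * gaussianPDF 0 1 (2 * a - e) *
          ENNReal.ofReal (2 * (a - e)) := by gcongr
    _ ≤ _ := by
        rw [mul_assoc]
        gcongr

lemma measurableSet_window (s a b : ℝ) :
    MeasurableSet {p : ℝ × ℝ | a < p.1 ^ 2 + s * p.2 ^ 2 ∧ p.1 ^ 2 + s * p.2 ^ 2 ≤ b} := by
  have h : Measurable fun p : ℝ × ℝ => p.1 ^ 2 + s * p.2 ^ 2 := by fun_prop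
  exact (measurableSet_lt measurable_const h).inter (measurableSet_le h measurable_const)

/-- The quadratic form `x² + s y²` charges a window of length `δ` below a level by at most a
constant times its mass above that level. -/
lemma gaussianReal_prod_window_le {s T δ : ℝ} (hδ : 0 ≤ δ) :
    ((gaussianReal 0 1).prod (gaussianReal 0 1))
        {p | T - δ < p.1 ^ 2 + s * p.2 ^ 2 ∧ p.1 ^ 2 + s * p.2 ^ 2 ≤ T} ≤
      ENNReal.ofReal (Real.exp (2 * δ)) *
        ((gaussianReal 0 1).prod (gaussianReal 0 1)) {p | T < p.1 ^ 2 + s * p.2 ^ 2} := by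
  rw [Measure.prod_apply_symm (measurableSet_window s _ _),
    Measure.prod_apply_symm (measurableSet_lt (by fun_prop) (by fun_prop)),
    ← lintegral_const_mul' _ _ ENNReal.ofReal_ne_top]
  refine lintegral_mono fun y => ?_
  convert gaussianReal_window_le (b := T - s * y ^ 2) hδ using 2
  · ext x
    simp only [Set.mem_preimage, Set.mem_ofPred_eq]
    exact and_congr ⟨fun h => by linarith, fun h => by linarith⟩
      ⟨fun h => by linarith, fun h => by linarith⟩
  · congr 1
    ext x
    simp only [Set.mem_preimage, Set.mem_ofPred_eq]
    exact ⟨fun h => by linarith, fun h => by linarith⟩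

/-- The cubed overshoot of `√w` above `t - 1/t` in terms of the overshoot of `w` above `t²`. -/
lemma cube_overshoot_le {w t : ℝ} (hw : 0 ≤ w) (ht : 1 < t) :
    (max (√w - (t - 1 / t)) 0) ^ 3 ≤ (1 / t) ^ 3 *
      (216 * (if t ^ 2 < w then Real.exp ((w - t ^ 2) / 4) else 0) +
        if t ^ 2 - 2 < w ∧ w ≤ t ^ 2 then 1 else 0) := by
  have ht0 : 0 < t := by linarith
  have hinv : 0 < 1 / t := by positivity
  have htinv : t * (1 / t) = 1 := by field_simp
  have hx : 0 ≤ √w := Real.sqrt_nonneg _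
  have hxw : √w ^ 2 = w := Real.sq_sqrt hw
  rcases lt_or_ge (t ^ 2) w with h | h
  · have htx : t < √w := Real.lt_sqrt_of_sq_lt h
    rw [if_pos h, if_neg (fun h' => h'.2.not_gt h), max_eq_left (by linarith), add_zero]
    have h1 : √w - (t - 1 / t) ≤ (1 / t) * (6 * Real.exp ((w - t ^ 2) / 12)) := by
      have h2 := Real.add_one_le_exp ((w - t ^ 2) / 12)
      have h3 : t * (√w - (t - 1 / t)) ≤ 6 * Real.exp ((w - t ^ 2) / 12) := by
        nlinarith
      calc √w - (t - 1 / t) = (1 / t) * (t * (√w - (t - 1 / t))) := by field_simp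
        _ ≤ _ := mul_le_mul_of_nonneg_left h3 hinv.le
    calc (√w - (t - 1 / t)) ^ 3
        ≤ ((1 / t) * (6 * Real.exp ((w - t ^ 2) / 12))) ^ 3 :=
          pow_le_pow_left₀ (by linarith) h1 3
      _ = _ := by
          rw [mul_pow, mul_pow, ← Real.exp_nat_mul]
          norm_num
          left
          ring
  · rw [if_neg h.not_gt, mul_zero, zero_add]
    rcases lt_or_ge (t ^ 2 - 2) w with h' | h'
    · have hxt : √w ≤ t := Real.sqrt_le_iff.2 ⟨ht0.le, h⟩
      rw [if_pos ⟨h', h⟩, mul_one]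
      exact pow_le_pow_left₀ (le_max_right _ _) (max_le (by linarith) hinv.le) 3
    · have hu : 1 / t < t := by
        rw [div_lt_iff₀ ht0]
        nlinarith
      have hxu : √w ≤ t - 1 / t := Real.sqrt_le_iff.2 ⟨by linarith, by nlinarith⟩
      rw [if_neg (fun h'' => h''.1.not_ge h'), max_eq_right (by linarith)]
      simp

/-- Third moment of the overshoot of the Gaussian norm `√(x² + s y²)`. -/
lemma lintegral_cube_overshoot_le {s t : ℝ} (hs : 0 ≤ s) (hs1 : s ≤ 1) (ht : 1 < t) :
    ∫⁻ p : ℝ × ℝ, ENNReal.ofReal ((max (√(p.1 ^ 2 + s * p.2 ^ 2) - (t - 1 / t)) 0) ^ 3)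
        ∂((gaussianReal 0 1).prod (gaussianReal 0 1)) ≤
      ENNReal.ofReal (3824 * (1 / t) ^ 3) *
        ((gaussianReal 0 1).prod (gaussianReal 0 1)) {p | t ^ 2 < p.1 ^ 2 + s * p.2 ^ 2} := by
  have ht0 : 0 < t := by linarith
  set ν := (gaussianReal 0 1).prod (gaussianReal 0 1) with hν
  have hset := measurableSet_window s (t ^ 2 - 2) (t ^ 2)
  have hexp4 : Real.exp (2 * 2) ≤ 3392 := by
    have h := Real.exp_one_lt_d9
    have : Real.exp (2 * 2) = Real.exp 1 ^ 4 := by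
      rw [← Real.exp_nat_mul]
      norm_num
    rw [this]
    calc Real.exp 1 ^ 4 ≤ 3 ^ 4 := pow_le_pow_left₀ (Real.exp_nonneg _) (by linarith) 4
      _ ≤ 3392 := by norm_num
  calc ∫⁻ p : ℝ × ℝ, ENNReal.ofReal ((max (√(p.1 ^ 2 + s * p.2 ^ 2) - (t - 1 / t)) 0) ^ 3) ∂ν
      ≤ ∫⁻ p : ℝ × ℝ, ENNReal.ofReal ((1 / t) ^ 3) *
          (216 * (if t ^ 2 < p.1 ^ 2 + s * p.2 ^ 2 then
            ENNReal.ofReal (Real.exp ((p.1 ^ 2 + s * p.2 ^ 2 - t ^ 2) / 4)) else 0) +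
          {p : ℝ × ℝ | t ^ 2 - 2 < p.1 ^ 2 + s * p.2 ^ 2 ∧
            p.1 ^ 2 + s * p.2 ^ 2 ≤ t ^ 2}.indicator 1 p) ∂ν := by
        refine lintegral_mono fun p => ?_
        refine (ENNReal.ofReal_le_ofReal
          (cube_overshoot_le (w := p.1 ^ 2 + s * p.2 ^ 2) (by positivity) ht)).trans_eq ?_
        rw [ENNReal.ofReal_mul (by positivity), ENNReal.ofReal_add (by positivity) (by positivity),
          ENNReal.ofReal_mul (by norm_num)]
        simp only [Set.indicator, Set.mem_ofPred_eq, Pi.one_apply, apply_ite ENNReal.ofReal,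
          ENNReal.ofReal_zero, ENNReal.ofReal_one, ENNReal.ofReal_ofNat]
    _ = ENNReal.ofReal ((1 / t) ^ 3) *
          (216 * ∫⁻ p : ℝ × ℝ, (if t ^ 2 < p.1 ^ 2 + s * p.2 ^ 2 then
            ENNReal.ofReal (Real.exp ((p.1 ^ 2 + s * p.2 ^ 2 - t ^ 2) / 4)) else 0) ∂ν +
          ν {p : ℝ × ℝ | t ^ 2 - 2 < p.1 ^ 2 + s * p.2 ^ 2 ∧
            p.1 ^ 2 + s * p.2 ^ 2 ≤ t ^ 2}) := by
        rw [lintegral_const_mul' _ _ ENNReal.ofReal_ne_top,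
          lintegral_add_right _ (measurable_one.indicator hset),
          lintegral_const_mul' _ _ (by norm_num), lintegral_indicator_one hset]
    _ ≤ ENNReal.ofReal ((1 / t) ^ 3) *
          (216 * (2 * ν {p | t ^ 2 < p.1 ^ 2 + s * p.2 ^ 2}) +
          ENNReal.ofReal 3392 * ν {p | t ^ 2 < p.1 ^ 2 + s * p.2 ^ 2}) := by
        gcongr
        · exact lintegral_exp_overshoot_le hs hs1 (by positivity)
        · refine (gaussianReal_prod_window_le (by norm_num)).trans ?_
          gcongr
    _ = _ := by
        rw [mul_comm (3824 : ℝ), ENNReal.ofReal_mul (by positivity), ENNReal.ofReal_ofNat,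
          ENNReal.ofReal_ofNat, ← mul_assoc 216, ← add_mul, mul_assoc]
        norm_num

/-- Let `X = √(g₁² + λ⁻¹ g₂²)` with `λ ≥ 1` and `g₁, g₂` independent standard Gaussians.
For every `t > 1` there is `0 < u < t` with `E (X-u)₊³ ≤ 3824 (t-u)³ P(X > t)`. -/
theorem stmt9 {Ω : Type*} [MeasureSpace Ω] [IsProbabilityMeasure (ℙ : Measure Ω)]
    (g₁ g₂ : Ω → ℝ) (hm₁ : Measurable g₁) (hm₂ : Measurable g₂)
    (hindep : IndepFun g₁ g₂ ℙ)
    (hg₁ : Measure.map g₁ ℙ = gaussianReal 0 1)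
    (hg₂ : Measure.map g₂ ℙ = gaussianReal 0 1)
    (lam : ℝ) (hlam : 1 ≤ lam)
    (X : Ω → ℝ) (hX : X = fun ω => Real.sqrt ((g₁ ω) ^ 2 + lam⁻¹ * (g₂ ω) ^ 2))
    (t : ℝ) (ht : 1 < t) :
    ∃ u : ℝ, 0 < u ∧ u < t ∧
      ∫ ω, (max (X ω - u) 0) ^ 3 ≤ 3824 * (t - u) ^ 3 * (ℙ {ω | t < X ω}).toReal := by
  have hs : 0 ≤ lam⁻¹ := by positivity
  have hs1 : lam⁻¹ ≤ 1 := inv_le_one_of_one_le₀ hlam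
  have ht0 : 0 < t := by linarith
  have hu : 1 / t < t := by
    rw [div_lt_iff₀ ht0]
    nlinarith
  have hinv : 0 < 1 / t := by positivity
  refine ⟨t - 1 / t, by linarith, by linarith, ?_⟩
  have hmap : Measure.map (fun ω => (g₁ ω, g₂ ω)) ℙ =
      (gaussianReal 0 1).prod (gaussianReal 0 1) := by
    rw [hindep.map_prod_eq_prod_map_map hm₁.aemeasurable hm₂.aemeasurable, hg₁, hg₂]
  have hpair : Measurable fun ω => (g₁ ω, g₂ ω) := hm₁.prodMk hm₂
  have hprob : (ℙ : Measure Ω) {ω | t < X ω} =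
      ((gaussianReal 0 1).prod (gaussianReal 0 1)) {p | t ^ 2 < p.1 ^ 2 + lam⁻¹ * p.2 ^ 2} := by
    rw [← hmap, Measure.map_apply hpair (measurableSet_lt (by fun_prop) (by fun_prop))]
    congr 1
    ext ω
    simp only [hX, Set.mem_ofPred_eq, Set.mem_preimage]
    exact Real.lt_sqrt ht0.le
  have hmoment := lintegral_cube_overshoot_le hs hs1 ht
  rw [← hmap, lintegral_map (by fun_prop) hpair, hmap, ← hprob] at hmoment
  have hcont : Measurable X := by
    rw [hX]
    fun_prop
  rw [integral_eq_lintegral_of_nonneg_ae (ae_of_all _ fun ω => by positivity) (by fun_prop),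
    sub_sub_cancel, ← ENNReal.toReal_ofReal (show 0 ≤ 3824 * (1 / t) ^ 3 by positivity),
    ← ENNReal.toReal_mul]
  refine ENNReal.toReal_mono (ENNReal.mul_ne_top ENNReal.ofReal_ne_top (measure_ne_top _ _)) ?_
  simpa only [hX] using hmoment
end
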